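/- Fix 0 < p < 1 and a real x with 0 ≤ x < p. Let t(k) be a sequence of nonnegative integers with t(k)/k → x as k → ∞. Then ln Pr( Δ(G(k,p)) ≤ t(k) ) / C(k,2) → −Λ*(x) as k → ∞, where Δ denotes maximum degree; in other words, the probability that the random graph G(k,p) has maximum degree at most t(k) equals exp( −C(k,2)·(Λ*(x) + o(1)) ). -/

import Mathlib

open MeasureTheory Filter
open scoped ENNReal NNReal

/-- The Bernoulli(p) measure on `Bool`. -/
noncomputable def bernoulliBool (p : ℝ) : Measure Bool :=
  p.toNNReal • Measure.dirac true + (1 - p).toNNReal • Measure.dirac false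

instance (p : ℝ) : IsFiniteMeasure (bernoulliBool p) := by
  unfold bernoulliBool; infer_instance

instance (n : ℕ) : MeasurableSpace (SimpleGraph (Fin n)) := ⊤

/-- The Erdős–Rényi random graph `G(n,p)`: the distribution of the simple graph on `Fin n`
obtained by including each possible edge independently with probability `p`. -/
noncomputable def erMeasure (n : ℕ) (p : ℝ) : Measure (SimpleGraph (Fin n)) :=
  Measure.map (fun f : Sym2 (Fin n) → Bool => SimpleGraph.fromEdgeSet {e | f e = true})
    (Measure.pi fun _ : Sym2 (Fin n) => bernoulliBool p)

/-- A set `S` of vertices is `t`-dependent if the induced subgraph has maximum degree at most `t`,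
i.e. every vertex of `S` has at most `t` neighbours inside `S`. -/
def IsTDependent {V : Type*} (G : SimpleGraph V) (t : ℕ) (S : Set V) : Prop :=
  ∀ v ∈ S, {u ∈ S | G.Adj v u}.ncard ≤ t

/-- The `t`-improper chromatic number: the least number of colours in a vertex colouring
in which every colour class is `t`-dependent. -/
noncomputable def improperChromaticNumber {V : Type*} (G : SimpleGraph V) (t : ℕ) : ℕ :=
  sInf {k | ∃ c : V → Fin k, ∀ i : Fin k, IsTDependent G t {v | c v = i}}

/-- The `t`-dependence number: the maximum size of a `t`-dependent set. -/
noncomputable def tDependenceNumber {V : Type*} (G : SimpleGraph V) (t : ℕ) : ℕ :=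
  sSup {m | ∃ S : Set V, S.ncard = m ∧ IsTDependent G t S}

/-- The Fenchel–Legendre transform `Λ*(x) = x ln(x/p) + (1-x) ln((1-x)/(1-p))`
(with the conventions `Λ*(0) = ln(1/(1-p))`, `Λ*(1) = ln(1/p)`, which hold automatically
since `Real.log 0 = 0` in Lean). -/
noncomputable def LambdaStar (p x : ℝ) : ℝ :=
  x * Real.log (x / p) + (1 - x) * Real.log ((1 - x) / (1 - p))

/-- The number of coordinates in `S` at which `f` takes the value `true`. -/
def trueCount {ι : Type*} (S : Finset ι) (f : ι → Bool) : ℕ :=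
  (S.filter fun e => f e = true).card

/-- The probability of `f : ι → Bool` under the product of Bernoulli(a) measures. -/
def bernoulliWeight {ι : Type*} [Fintype ι] (a : ℝ) (f : ι → Bool) : ℝ :=
  ∏ e, if f e = true then a else 1 - a

section ProductWeight

variable {ι : Type*} [Fintype ι]

theorem bernoulliWeight_nonneg {a : ℝ} (h0 : 0 ≤ a) (h1 : a ≤ 1) (f : ι → Bool) :
    0 ≤ bernoulliWeight a f := by
  refine Finset.prod_nonneg fun e _ => ?_
  split_ifs
  · exact h0
  · linarith

theorem pow_trueCount [DecidableEq ι] (S : Finset ι) (f : ι → Bool) (s : ℝ) :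
    s ^ trueCount S f = ∏ e, if e ∈ S ∧ f e = true then s else 1 := by
  rw [trueCount, ← Finset.prod_const, Finset.prod_filter, ← Finset.prod_subset (Finset.subset_univ S)]
  · exact Finset.prod_congr rfl fun e he => by simp [he]
  · intro e _ he
    simp [he]

theorem sum_bernoulliWeight_mul_pow [DecidableEq ι] (a s : ℝ) (S : Finset ι) :
    ∑ f : ι → Bool, bernoulliWeight a f * s ^ trueCount S f = (1 - a + a * s) ^ S.card := by
  have key := Finset.prod_univ_sum (fun _ : ι => (Finset.univ : Finset Bool))
    (fun e b => (if b = true then a else 1 - a) * (if e ∈ S ∧ b = true then s else 1))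
  rw [Fintype.piFinset_univ] at key
  simp_rw [pow_trueCount, bernoulliWeight, ← Finset.prod_mul_distrib]
  rw [← key, ← Finset.prod_const, ← Finset.prod_subset (Finset.subset_univ S)]
  · refine Finset.prod_congr rfl fun e he => ?_
    simp [he]
    ring
  · intro e _ he
    simp [he]

theorem sum_bernoulliWeight [DecidableEq ι] (a : ℝ) :
    ∑ f : ι → Bool, bernoulliWeight a f = 1 := by
  simpa using sum_bernoulliWeight_mul_pow a 1 (∅ : Finset ι)

theorem sum_filter_bernoulliWeight_le [DecidableEq ι] {a s m : ℝ} (h0 : 0 ≤ a) (h1 : a ≤ 1)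
    (hs : 0 < s) (S : Finset ι) (B : (ι → Bool) → Prop) [DecidablePred B]
    (hB : ∀ f, B f → s ^ m ≤ s ^ (trueCount S f : ℝ)) :
    ∑ f with B f, bernoulliWeight a f ≤ s ^ (-m) * (1 - a + a * s) ^ S.card := by
  rw [← sum_bernoulliWeight_mul_pow, Finset.mul_sum, Finset.sum_filter]
  refine Finset.sum_le_sum fun f _ => ?_
  have hw := bernoulliWeight_nonneg h0 h1 f
  split_ifs with h
  · have h2 := hB f h
    rw [Real.rpow_natCast] at h2
    have h3 : 1 ≤ s ^ (-m) * s ^ trueCount S f := by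
      calc (1 : ℝ) = s ^ (-m) * s ^ m := by rw [← Real.rpow_add hs]; simp
        _ ≤ _ := by gcongr
    calc bernoulliWeight a f = bernoulliWeight a f * 1 := (mul_one _).symm
      _ ≤ bernoulliWeight a f * (s ^ (-m) * s ^ trueCount S f) := by gcongr
      _ = _ := by ring
  · positivity

/-- A Hoeffding-type bound for both tails of a binomial count. -/
theorem sum_filter_bernoulliWeight_le_exp [DecidableEq ι] {a b : ℝ} (h0 : 0 ≤ a) (h1 : a ≤ 1)
    (hb0 : 0 ≤ b) (hb1 : b ≤ 1) (S : Finset ι) (B : (ι → Bool) → Prop) [DecidablePred B]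
    (hB : ∀ f, B f → 0 ≤ (b - a) * (trueCount S f - b * S.card)) :
    ∑ f with B f, bernoulliWeight a f ≤ Real.exp (-((b - a) ^ 2 / 4 * S.card)) := by
  set u : ℝ := (b - a) / 2 with hu
  refine (sum_filter_bernoulliWeight_le (s := Real.exp u) (m := b * S.card) h0 h1
    (Real.exp_pos u) S B ?_).trans ?_
  · intro f hf
    rw [← Real.exp_mul, ← Real.exp_mul, Real.exp_le_exp]
    rw [hu]
    linarith [hB f hf]
  · have hu1 : |u| ≤ 1 := by
      rw [abs_le]; constructor <;> linarith
    have h2 : Real.exp u ≤ 1 + u + u ^ 2 := by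
      have := (abs_le.1 (Real.abs_exp_sub_one_sub_id_le hu1)).2
      linarith
    have h3 : 1 - a + a * Real.exp u ≤ Real.exp (a * (u + u ^ 2)) := by
      have := Real.add_one_le_exp (a * (u + u ^ 2))
      nlinarith
    have h4 : (1 - a + a * Real.exp u) ^ S.card ≤ Real.exp (a * (u + u ^ 2) * S.card) := by
      rw [mul_comm _ (S.card : ℝ), Real.exp_nat_mul]
      refine pow_le_pow_left₀ ?_ h3 _
      have := mul_nonneg h0 (Real.exp_pos u).le
      linarith
    rw [← Real.exp_mul]
    calc _ ≤ Real.exp (u * -(b * S.card)) * Real.exp (a * (u + u ^ 2) * S.card) := by gcongr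
      _ = Real.exp ((u * (a - b + a * u)) * S.card) := by rw [← Real.exp_add]; ring_nf
      _ ≤ _ := by
        rw [Real.exp_le_exp, ← neg_mul]
        refine mul_le_mul_of_nonneg_right ?_ (Nat.cast_nonneg _)
        rw [hu]
        nlinarith [mul_nonneg (sub_nonneg.2 h1) (sq_nonneg (b - a))]

theorem bernoulliWeight_eq_mul [DecidableEq ι] {a p : ℝ} (ha0 : 0 < a) (ha1 : a < 1) (hp1 : p < 1)
    (f : ι → Bool) :
    bernoulliWeight p f = bernoulliWeight a f * (((1 - p) / (1 - a)) ^ Fintype.card ι *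
      (p * (1 - a) / (a * (1 - p))) ^ trueCount Finset.univ f) := by
  rw [pow_trueCount, ← Finset.card_univ, ← Finset.prod_const, bernoulliWeight, bernoulliWeight,
    ← Finset.prod_mul_distrib, ← Finset.prod_mul_distrib]
  refine Finset.prod_congr rfl fun e _ => ?_
  have : 1 - a ≠ 0 := by linarith
  have : 1 - p ≠ 0 := by linarith
  by_cases h : f e = true
  · simp only [h, if_true, Finset.mem_univ, and_self]
    field_simp
  · simp only [h, Finset.mem_univ]
    simp
    field_simp

end ProductWeight

theorem bernoulliBool_singleton {p : ℝ} (b : Bool) :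
    bernoulliBool p {b} = ENNReal.ofReal (if b = true then p else 1 - p) := by
  cases b <;> simp [bernoulliBool, ENNReal.ofReal]

open Classical in
theorem erMeasure_toReal {p : ℝ} (hp0 : 0 ≤ p) (hp1 : p ≤ 1) (n : ℕ)
    (A : Set (SimpleGraph (Fin n))) :
    (erMeasure n p A).toReal =
      ∑ f : Sym2 (Fin n) → Bool with SimpleGraph.fromEdgeSet {e | f e = true} ∈ A,
        bernoulliWeight p f := by
  rw [erMeasure, Measure.map_apply (measurable_of_countable _) (by trivial)]
  have h : ((fun f : Sym2 (Fin n) → Bool => SimpleGraph.fromEdgeSet {e | f e = true}) ⁻¹' A) =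
      ((Finset.univ.filter fun f : Sym2 (Fin n) → Bool =>
        SimpleGraph.fromEdgeSet {e | f e = true} ∈ A : Finset _) : Set (Sym2 (Fin n) → Bool)) := by
    ext f
    simp
  rw [h, ← sum_measure_singleton, ENNReal.toReal_sum (fun f _ => measure_ne_top _ _)]
  refine Finset.sum_congr rfl fun f _ => ?_
  rw [Measure.pi_singleton, ENNReal.toReal_prod, bernoulliWeight]
  refine Finset.prod_congr rfl fun e _ => ?_
  rw [bernoulliBool_singleton, ENNReal.toReal_ofReal]
  split_ifs <;> linarith

theorem ncard_neighborSet_le_trueCount {n : ℕ} (f : Sym2 (Fin n) → Bool) (v : Fin n) :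
    ((SimpleGraph.fromEdgeSet {e | f e = true}).neighborSet v).ncard ≤
      trueCount (Finset.univ.image fun u => s(v, u)) f := by
  rw [trueCount, ← Set.ncard_coe_finset]
  refine Set.ncard_le_ncard_of_injOn (fun u => s(v, u)) ?_ ?_ (Set.toFinite _)
  · intro u hu
    simp at hu
    simp [hu.1]
  · intro u _ w _ h
    exact Sym2.congr_right.1 h

theorem card_image_mk {n : ℕ} (v : Fin n) :
    (Finset.univ.image fun u => s(v, u)).card = n := by
  rw [Finset.card_image_of_injective]
  · simp
  · intro u w h
    exact Sym2.congr_right.1 h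

/-- The number of edges is at most half the sum of the degrees. -/
theorem two_mul_trueCount_le {n t : ℕ} (f : Sym2 (Fin n) → Bool)
    (h : ∀ v, ((SimpleGraph.fromEdgeSet {e | f e = true}).neighborSet v).ncard ≤ t) :
    2 * trueCount (Finset.univ.filter fun e : Sym2 (Fin n) => ¬ e.IsDiag) f ≤ n * t := by
  classical
  set G := SimpleGraph.fromEdgeSet {e | f e = true} with hG
  have h1 : trueCount (Finset.univ.filter fun e : Sym2 (Fin n) => ¬ e.IsDiag) f =
      G.edgeFinset.card := by
    rw [trueCount]
    congr 1
    ext e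
    simp [hG, and_comm]
  have h2 : ∑ v, G.degree v = 2 * G.edgeFinset.card := by
    convert G.sum_degrees_eq_twice_card_edges
  rw [h1, ← h2]
  refine (Finset.sum_le_card_nsmul _ _ t fun v _ => ?_).trans (by simp)
  rw [← G.card_neighborSet_eq_degree, ← Set.toFinset_card, ← Set.ncard_eq_toFinset_card']
  exact h v

theorem card_filter_not_isDiag (n : ℕ) :
    (Finset.univ.filter fun e : Sym2 (Fin n) => ¬ e.IsDiag).card = n.choose 2 := by
  have := Sym2.card_subtype_not_diag (α := Fin n)
  rwa [Fintype.card_subtype, Fintype.card_fin] at this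

/-- Markov's inequality for the number of edges. -/
theorem erMeasure_maxDegree_le {p s : ℝ} (hp0 : 0 ≤ p) (hp1 : p ≤ 1) (hs0 : 0 < s) (hs1 : s ≤ 1)
    (n t : ℕ) :
    (erMeasure n p {G | ∀ v, (G.neighborSet v).ncard ≤ t}).toReal ≤
      s ^ (-((n : ℝ) * t / 2)) * (1 - p + p * s) ^ n.choose 2 := by
  classical
  rw [erMeasure_toReal hp0 hp1, ← card_filter_not_isDiag]
  convert sum_filter_bernoulliWeight_le hp0 hp1 hs0 _ (fun f : Sym2 (Fin n) → Bool =>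
    SimpleGraph.fromEdgeSet {e | f e = true} ∈
      {G : SimpleGraph (Fin n) | ∀ v, (G.neighborSet v).ncard ≤ t}) fun f hf => ?_ using 1
  · congr
  · refine Real.rpow_le_rpow_of_exponent_ge hs0 hs1 ?_
    have h := two_mul_trueCount_le f hf
    have h' : (2 : ℝ) * trueCount (Finset.univ.filter fun e : Sym2 (Fin n) => ¬ e.IsDiag) f ≤
      n * t := by exact_mod_cast h
    linarith

/-- Lower bound by tilting the edge probability from `p` to `a`. -/
theorem le_erMeasure_maxDegree {p a b c : ℝ} (hap : a < p) (hp1 : p < 1) (hc0 : 0 ≤ c)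
    (hca : c < a) (hab : a < b) (hb1 : b ≤ 1) {n t : ℕ} (ht : b * n ≤ t) :
    (1 - n * Real.exp (-((b - a) ^ 2 / 4 * n)) -
        Real.exp (-((c - a) ^ 2 / 4 * (n + 1).choose 2))) *
      (((1 - p) / (1 - a)) ^ (n + 1).choose 2 *
        (p * (1 - a) / (a * (1 - p))) ^ (c * (n + 1).choose 2)) ≤
      (erMeasure n p {G | ∀ v, (G.neighborSet v).ncard ≤ t}).toReal := by
  classical
  have ha0 : 0 < a := by linarith
  have ha1 : a < 1 := by linarith
  have hp0 : 0 < p := by linarith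
  set r : ℝ := p * (1 - a) / (a * (1 - p)) with hr
  have hr1 : 1 ≤ r := by
    rw [hr, le_div_iff₀ (mul_pos ha0 (by linarith))]
    nlinarith
  have hM : Fintype.card (Sym2 (Fin n)) = (n + 1).choose 2 := by
    rw [Sym2.card, Fintype.card_fin]
  set M := (n + 1).choose 2
  set C : ℝ := ((1 - p) / (1 - a)) ^ M * r ^ (c * M) with hC
  have hC0 : 0 ≤ C := by
    have : 0 ≤ (1 - p) / (1 - a) := div_nonneg (by linarith) (by linarith)
    positivity
  set A : (Sym2 (Fin n) → Bool) → Prop := fun f =>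
    SimpleGraph.fromEdgeSet {e | f e = true} ∈
      {G : SimpleGraph (Fin n) | ∀ v, (G.neighborSet v).ncard ≤ t} with hA
  set D : (Sym2 (Fin n) → Bool) → Prop := fun f => c * M ≤ trueCount Finset.univ f with hD
  rw [erMeasure_toReal hp0.le hp1.le]
  have hw (f : Sym2 (Fin n) → Bool) := bernoulliWeight_nonneg ha0.le ha1.le f
  have hdeg (v : Fin n) : ∑ f : Sym2 (Fin n) → Bool with
      b * n ≤ trueCount (Finset.univ.image fun u => s(v, u)) f, bernoulliWeight a f ≤
      Real.exp (-((b - a) ^ 2 / 4 * n)) := by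
    have := sum_filter_bernoulliWeight_le_exp ha0.le ha1.le (by linarith : 0 ≤ b) hb1
      (Finset.univ.image fun u => s(v, u))
      (fun f => b * n ≤ trueCount (Finset.univ.image fun u => s(v, u)) f)
    rw [card_image_mk] at this
    exact this fun f hf => mul_nonneg (by linarith) (by linarith)
  have hedge : ∑ f : Sym2 (Fin n) → Bool with ¬ D f, bernoulliWeight a f ≤
      Real.exp (-((c - a) ^ 2 / 4 * M)) := by
    have := sum_filter_bernoulliWeight_le_exp ha0.le ha1.le hc0 (by linarith : c ≤ 1)
      (Finset.univ : Finset (Sym2 (Fin n))) (fun f => ¬ D f)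
    rw [Finset.card_univ, hM] at this
    refine this fun f hf => ?_
    have := not_le.1 hf
    exact mul_nonneg_of_nonpos_of_nonpos (by linarith) (by linarith)
  have hcover : (1 : ℝ) ≤ ∑ f with A f ∧ D f, bernoulliWeight a f +
      ((∑ v : Fin n, ∑ f : Sym2 (Fin n) → Bool with
        b * n ≤ trueCount (Finset.univ.image fun u => s(v, u)) f, bernoulliWeight a f) +
      ∑ f : Sym2 (Fin n) → Bool with ¬ D f, bernoulliWeight a f) := by
    rw [← sum_bernoulliWeight (ι := Sym2 (Fin n)) a]
    simp_rw [Finset.sum_filter]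
    rw [Finset.sum_comm, ← Finset.sum_add_distrib, ← Finset.sum_add_distrib]
    refine Finset.sum_le_sum fun f _ => ?_
    have hnn : 0 ≤ ∑ v : Fin n, if b * n ≤ trueCount (Finset.univ.image fun u => s(v, u)) f then
        bernoulliWeight a f else 0 :=
      Finset.sum_nonneg fun v _ => by split_ifs; exacts [hw f, le_rfl]
    by_cases hDf : D f
    · by_cases hAf : A f
      · simp [hDf, hAf, hnn]
      · obtain ⟨v, hv⟩ : ∃ v, t < ((SimpleGraph.fromEdgeSet {e | f e = true}).neighborSet v).ncard := by
          simpa [hA] using hAf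
        have hv' : b * n ≤ trueCount (Finset.univ.image fun u => s(v, u)) f := by
          refine ht.trans ?_
          exact_mod_cast hv.le.trans (ncard_neighborSet_le_trueCount f v)
        have := Finset.single_le_sum (f := fun v : Fin n =>
          if b * n ≤ trueCount (Finset.univ.image fun u => s(v, u)) f then
            bernoulliWeight a f else 0) (fun v _ => by split_ifs; exacts [hw f, le_rfl])
            (Finset.mem_univ v)
        simp only [hv', if_true] at this
        simpa [hDf, hAf] using this
    · simp [hDf, hnn]
  have hmain : 1 - n * Real.exp (-((b - a) ^ 2 / 4 * n)) - Real.exp (-((c - a) ^ 2 / 4 * M)) ≤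
      ∑ f with A f ∧ D f, bernoulliWeight a f := by
    have h1 := Finset.sum_le_sum fun (v : Fin n) (_ : v ∈ Finset.univ) => hdeg v
    simp only [Finset.sum_const, Finset.card_univ, Fintype.card_fin, nsmul_eq_mul] at h1
    linarith
  refine (mul_le_mul_of_nonneg_right hmain hC0).trans ?_
  rw [Finset.sum_mul]
  calc _ ≤ ∑ f with A f ∧ D f, bernoulliWeight p f := by
        refine Finset.sum_le_sum fun f hf => ?_
        rw [bernoulliWeight_eq_mul ha0 ha1 hp1 f, hM, hC, ← Real.rpow_natCast r]
        have hDf : D f := (Finset.mem_filter.1 hf).2.2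
        have : 0 ≤ (1 - p) / (1 - a) := div_nonneg (by linarith) (by linarith)
        have := hw f
        gcongr
    _ ≤ _ := by
        refine Finset.sum_le_sum_of_subset_of_nonneg ?_ fun f _ _ =>
          bernoulliWeight_nonneg hp0.le hp1.le f
        intro f hf
        simp only [Finset.mem_filter] at hf ⊢
        exact ⟨hf.1, hf.2.1⟩

theorem pow_le_erMeasure_maxDegree {p : ℝ} (hp0 : 0 ≤ p) (hp1 : p ≤ 1) (n t : ℕ) :
    (1 - p) ^ (n + 1).choose 2 ≤
      (erMeasure n p {G | ∀ v, (G.neighborSet v).ncard ≤ t}).toReal := by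
  classical
  rw [erMeasure_toReal hp0 hp1]
  have h : bernoulliWeight p (fun _ : Sym2 (Fin n) => false) = (1 - p) ^ (n + 1).choose 2 := by
    simp [bernoulliWeight, Sym2.card]
  rw [← h]
  refine Finset.single_le_sum (f := fun f => bernoulliWeight p f)
    (fun f _ => bernoulliWeight_nonneg hp0 hp1 f) ?_
  simp [SimpleGraph.neighborSet]

theorem tendsto_natCast_mul_exp_neg {δ : ℝ} (hδ : 0 < δ) :
    Tendsto (fun n : ℕ => (n : ℝ) * Real.exp (-(δ * n))) atTop (nhds 0) := by
  have h := (Real.tendsto_pow_mul_exp_neg_atTop_nhds_zero 1).comp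
    (tendsto_natCast_atTop_atTop.const_mul_atTop hδ)
  have h' := h.const_mul δ⁻¹
  rw [mul_zero] at h'
  refine h'.congr fun n => ?_
  simp only [Function.comp, pow_one]
  field_simp

theorem tendsto_choose_two_atTop :
    Tendsto (fun n : ℕ => ((n.choose 2 : ℕ) : ℝ)) atTop atTop := by
  refine tendsto_natCast_atTop_atTop.comp ?_
  refine tendsto_atTop_mono' _ ?_ (tendsto_sub_atTop_nat 1)
  filter_upwards [eventually_ge_atTop 2] with n hn
  obtain ⟨m, rfl⟩ := Nat.exists_eq_add_of_le hn
  rw [Nat.choose_two_right, Nat.le_div_iff_mul_le two_pos, mul_comm (2 + m)]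
  exact Nat.mul_le_mul_left _ (by omega)

theorem tendsto_natCast_div_sub_one :
    Tendsto (fun n : ℕ => (n : ℝ) / ((n : ℝ) - 1)) atTop (nhds 1) := by
  have h := (tendsto_natCast_div_add_atTop (-1 : ℝ))
  simpa [sub_eq_add_neg] using h

theorem tendsto_choose_two_succ_div :
    Tendsto (fun n : ℕ => ((n + 1).choose 2 : ℝ) / (n.choose 2 : ℝ)) atTop (nhds 1) := by
  have h1 : Tendsto (fun n : ℕ => 2 * ((n : ℝ) / ((n : ℝ) - 1)) - 1) atTop (nhds 1) := by
    have := (tendsto_natCast_div_sub_one.const_mul 2).sub_const 1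
    norm_num at this
    exact this
  refine h1.congr' ?_
  filter_upwards [eventually_ge_atTop 2] with n hn
  have hn' : (2 : ℝ) ≤ n := by exact_mod_cast hn
  have h2 : (n : ℝ) - 1 ≠ 0 := by linarith
  have h3 : (n : ℝ) ≠ 0 := by linarith
  rw [Nat.cast_choose_two, Nat.cast_choose_two]
  push_cast
  field_simp
  ring

theorem neg_LambdaStar_eq {p x : ℝ} (hp0 : 0 < p) (hp1 : p < 1) (hx0 : 0 < x) (hx1 : x < 1) :
    -LambdaStar p x =
      Real.log ((1 - p) / (1 - x)) + x * Real.log (p * (1 - x) / (x * (1 - p))) := by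
  have h1 : (1 - p) ≠ 0 := by linarith
  have h2 : (1 - x) ≠ 0 := by linarith
  rw [LambdaStar, Real.log_div hx0.ne' hp0.ne', Real.log_div h2 h1, Real.log_div h1 h2,
    Real.log_div (mul_ne_zero hp0.ne' h2) (mul_ne_zero hx0.ne' h1), Real.log_mul hp0.ne' h2,
    Real.log_mul hx0.ne' h1]
  ring

theorem neg_LambdaStar_zero (p : ℝ) : -LambdaStar p 0 = Real.log (1 - p) := by
  simp [LambdaStar]

theorem exists_tilt_lt {p x u : ℝ} (hp0 : 0 < p) (hp1 : p < 1) (hx0 : 0 ≤ x) (hxp : x < p)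
    (hu : -LambdaStar p x < u) :
    ∃ s, 0 < s ∧ s ≤ 1 ∧ -x * Real.log s + Real.log (1 - p + p * s) < u := by
  rcases hx0.eq_or_lt with rfl | hx
  · rw [neg_LambdaStar_zero] at hu
    have hc : ContinuousAt (fun s : ℝ => Real.log (1 - p + p * s)) 0 := by
      refine ContinuousAt.log (by fun_prop) ?_
      simp only [mul_zero, add_zero]
      linarith
    have h1 : ∀ᶠ s in nhds (0 : ℝ), Real.log (1 - p + p * s) < u :=
      hc.eventually_lt_const (by simpa using hu)
    have h2 := (h1.filter_mono nhdsWithin_le_nhds).and (Ioo_mem_nhdsGT (zero_lt_one (α := ℝ)))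
    obtain ⟨s, hs, hs'⟩ := h2.exists
    exact ⟨s, hs'.1, hs'.2.le, by simpa using hs⟩
  · have hq : 0 < 1 - p := by linarith
    have hy : 0 < 1 - x := by linarith
    refine ⟨(p * (1 - x) / (x * (1 - p)))⁻¹, by positivity, ?_, ?_⟩
    · rw [inv_div, div_le_one (by positivity)]
      nlinarith
    · have h : 1 - p + p * (p * (1 - x) / (x * (1 - p)))⁻¹ = (1 - p) / (1 - x) := by
        field_simp
        ring
      rw [h, Real.log_inv]
      rw [neg_LambdaStar_eq hp0 hp1 hx (by linarith)] at hu
      linarith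

theorem eventually_log_erMeasure_maxDegree_lt {p x u : ℝ} (hp0 : 0 < p) (hp1 : p < 1)
    (hx0 : 0 ≤ x) (hxp : x < p) {t : ℕ → ℕ}
    (ht : Tendsto (fun k => (t k : ℝ) / (k : ℝ)) atTop (nhds x)) (hu : -LambdaStar p x < u) :
    ∀ᶠ k in atTop,
      Real.log ((erMeasure k p {G | ∀ v, (G.neighborSet v).ncard ≤ t k}).toReal) /
        (k.choose 2 : ℝ) < u := by
  obtain ⟨s, hs0, hs1, hs⟩ := exists_tilt_lt hp0 hp1 hx0 hxp hu
  have hlim : Tendsto (fun k : ℕ => -((t k : ℝ) / k * ((k : ℝ) / ((k : ℝ) - 1))) * Real.log s +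
      Real.log (1 - p + p * s)) atTop (nhds (-x * Real.log s + Real.log (1 - p + p * s))) := by
    have := (((ht.mul tendsto_natCast_div_sub_one).neg.mul_const (Real.log s)).add_const
      (Real.log (1 - p + p * s)))
    rwa [mul_one] at this
  filter_upwards [hlim.eventually_lt_const hs, eventually_ge_atTop 2] with k hk hk2
  refine lt_of_le_of_lt ?_ hk
  have hk' : (2 : ℝ) ≤ k := by exact_mod_cast hk2
  have h1 : (k : ℝ) - 1 ≠ 0 := by linarith
  have h0 : (k : ℝ) ≠ 0 := by linarith
  have hN : (0 : ℝ) < k.choose 2 := by exact_mod_cast Nat.choose_pos hk2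
  have hb : 0 < 1 - p + p * s := by nlinarith [mul_pos hp0 hs0]
  have hP := lt_of_lt_of_le (pow_pos (sub_pos.2 hp1) _)
    (pow_le_erMeasure_maxDegree hp0.le hp1.le k (t k))
  have hlog := Real.log_le_log hP (erMeasure_maxDegree_le hp0.le hp1.le hs0 hs1 k (t k))
  rw [Real.log_mul (Real.rpow_pos_of_pos hs0 _).ne' (pow_pos hb _).ne', Real.log_rpow hs0,
    Real.log_pow] at hlog
  rw [div_le_iff₀ hN]
  refine hlog.trans (le_of_eq ?_)
  rw [Nat.cast_choose_two]
  field_simp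

theorem eventually_lt_log_erMeasure_maxDegree {p x l : ℝ} (hp0 : 0 < p) (hp1 : p < 1)
    (hx0 : 0 ≤ x) (hxp : x < p) {t : ℕ → ℕ}
    (ht : Tendsto (fun k => (t k : ℝ) / (k : ℝ)) atTop (nhds x)) (hl : l < -LambdaStar p x) :
    ∀ᶠ k in atTop,
      l < Real.log ((erMeasure k p {G | ∀ v, (G.neighborSet v).ncard ≤ t k}).toReal) /
        (k.choose 2 : ℝ) := by
  rcases hx0.eq_or_lt with rfl | hx
  · rw [neg_LambdaStar_zero] at hl
    have hlim := tendsto_choose_two_succ_div.mul_const (Real.log (1 - p))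
    rw [one_mul] at hlim
    filter_upwards [hlim.eventually_const_lt hl, eventually_ge_atTop 2] with k hk hk2
    refine lt_of_lt_of_le hk ?_
    have hlog := Real.log_le_log (pow_pos (sub_pos.2 hp1) _)
      (pow_le_erMeasure_maxDegree hp0.le hp1.le k (t k))
    rw [Real.log_pow] at hlog
    rw [div_mul_eq_mul_div]
    gcongr
  · rw [neg_LambdaStar_eq hp0 hp1 hx (by linarith)] at hl
    have hq : 0 < 1 - p := by linarith
    have hy : 0 < 1 - x := by linarith
    have hc : ContinuousAt (fun η : ℝ => Real.log ((1 - p) / (1 - (x - η))) +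
        (x - 2 * η) * Real.log (p * (1 - (x - η)) / ((x - η) * (1 - p)))) 0 := by
      refine ContinuousAt.add ?_ (ContinuousAt.mul (by fun_prop) ?_)
      · refine ContinuousAt.log (ContinuousAt.div (by fun_prop) (by fun_prop) ?_) ?_
        · simp only [sub_zero]; positivity
        · simp only [sub_zero]; positivity
      · refine ContinuousAt.log (ContinuousAt.div (by fun_prop) (by fun_prop) ?_) ?_
        · simp only [sub_zero]; positivity
        · simp only [sub_zero]; positivity
    have h1 := hc.eventually_const_lt (u := l) (by simpa using hl)
    have h2 := (h1.filter_mono nhdsWithin_le_nhds).and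
      (Ioo_mem_nhdsGT (show (0 : ℝ) < x / 2 by linarith))
    obtain ⟨η, hη, hη0, hη1⟩ := h2.exists
    set a := x - η with ha
    set b := x - η / 2 with hb
    set c := x - 2 * η with hc'
    have ha0 : 0 < a := by linarith
    have ha1 : 0 < 1 - a := by linarith
    have hδ : 0 < (b - a) ^ 2 / 4 := by
      have : b - a ≠ 0 := by linarith
      positivity
    have hδ' : 0 < (c - a) ^ 2 / 4 := by
      have : c - a ≠ 0 := by linarith
      positivity
    set g := Real.log ((1 - p) / (1 - a)) + c * Real.log (p * (1 - a) / (a * (1 - p))) with hg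
    have hpre : Tendsto (fun k : ℕ => 1 - k * Real.exp (-((b - a) ^ 2 / 4 * k)) -
        Real.exp (-((c - a) ^ 2 / 4 * (k + 1).choose 2))) atTop (nhds 1) := by
      have e1 := tendsto_natCast_mul_exp_neg hδ
      have e2 : Tendsto (fun k : ℕ => Real.exp (-((c - a) ^ 2 / 4 * (k + 1).choose 2)))
          atTop (nhds 0) :=
        Real.tendsto_exp_neg_atTop_nhds_zero.comp
          ((tendsto_choose_two_atTop.comp (tendsto_add_atTop_nat 1)).const_mul_atTop hδ')
      simpa using (e1.const_sub 1).sub e2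
    have hlim : Tendsto (fun k : ℕ => Real.log (1 / 2) / (k.choose 2 : ℝ) +
        ((k + 1).choose 2 : ℝ) / (k.choose 2 : ℝ) * g) atTop (nhds g) := by
      simpa using (tendsto_choose_two_atTop.const_div_atTop (Real.log (1 / 2))).add
        (tendsto_choose_two_succ_div.mul_const g)
    filter_upwards [hlim.eventually_const_lt hη,
      hpre.eventually_const_lt (show (1 / 2 : ℝ) < 1 by norm_num),
      ht.eventually_const_lt (show b < x by linarith), eventually_ge_atTop 2] with k hk hk1 hkt hk2
    refine lt_of_lt_of_le hk ?_
    have hk0 : (0 : ℝ) < k := by exact_mod_cast (by omega : 0 < k)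
    have hbt : b * k ≤ t k := ((lt_div_iff₀ hk0).1 hkt).le
    have hle := le_erMeasure_maxDegree (by linarith : a < p) hp1 (by linarith : 0 ≤ c)
      (by linarith : c < a) (by linarith : a < b) (by linarith : b ≤ 1) hbt
    have hr : 0 < p * (1 - a) / (a * (1 - p)) := by positivity
    have hC1 : 0 < ((1 - p) / (1 - a)) ^ (k + 1).choose 2 := by positivity
    have hC2 := Real.rpow_pos_of_pos hr (c * (k + 1).choose 2)
    have hle' := (mul_le_mul_of_nonneg_right hk1.le (mul_pos hC1 hC2).le).trans hle
    have hlog := Real.log_le_log (by positivity) hle'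
    rw [Real.log_mul (by norm_num) (mul_pos hC1 hC2).ne', Real.log_mul hC1.ne' hC2.ne',
      Real.log_pow, Real.log_rpow hr] at hlog
    rw [div_mul_eq_mul_div, ← add_div]
    gcongr
    refine le_trans (le_of_eq ?_) hlog
    rw [hg]
    ring

/-- Fix `0 < p < 1` and `0 ≤ x < p`; suppose `t(k)/k → x`.  Then
`Pr(Δ(G(k,p)) ≤ t(k)) = exp(-C(k,2)·(Λ*(x) + o(1)))`, i.e.
`ln Pr(Δ(G(k,p)) ≤ t(k)) / C(k,2) → -Λ*(x)` as `k → ∞`. -/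
theorem stmt12 (p : ℝ) (hp0 : 0 < p) (hp1 : p < 1) (x : ℝ) (hx0 : 0 ≤ x) (hxp : x < p)
    (t : ℕ → ℕ) (ht : Tendsto (fun k => (t k : ℝ) / (k : ℝ)) atTop (nhds x)) :
    Tendsto (fun k =>
        Real.log ((erMeasure k p {G | ∀ v, (G.neighborSet v).ncard ≤ t k}).toReal) /
          (k.choose 2 : ℝ))
      atTop (nhds (-LambdaStar p x)) := by
  exact tendsto_order.2 ⟨fun _ hl => eventually_lt_log_erMeasure_maxDegree hp0 hp1 hx0 hxp ht hl,
    fun _ hu => eventually_log_erMeasure_maxDegree_lt hp0 hp1 hx0 hxp ht hu⟩
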